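/- arXiv:2405.15990 — 6 statements merged into one kernel-verified Lean document; each statement's English description precedes it below -/
import Mathlib

section
/- Let X, F, J, δ, L and the VIJI iterates (x_k, v_k, s_k, λ_k) with η = 10 be as in the context, with F L-smooth on X and J a δ-inexact Jacobian. Define the Lyapunov function E_k = max_{v ∈ X} { ⟨s_k, v − x_0⟩ − (1/2)∥v − x_0∥² }. Then for every integer T ≥ 1 and every x ∈ X: ∑_{k=1}^T λ_k ⟨F(x_k), x_k − x⟩ ≤ E_0 − E_T + ⟨s_T, x − x_0⟩ − (1/8) ∑_{k=1}^T ∥x_k − v_k∥². -/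
open scoped RealInnerProductSpace

section Auxiliary

variable {E : Type*} [NormedAddCommGroup E] [InnerProductSpace ℝ E]

/-- First-order Taylor bound for a map whose derivative is Lipschitz on a convex set. -/
theorem norm_image_sub_sub_fderiv_le {X : Set E} (hX : Convex ℝ X) {F : E → E}
    {F' : E → E →L[ℝ] E} (hF' : ∀ x, HasFDerivAt F (F' x) x) {L : ℝ}
    (hsmooth : ∀ x ∈ X, ∀ y ∈ X, ‖F' x - F' y‖ ≤ L * ‖x - y‖)
    {v x : E} (hv : v ∈ X) (hx : x ∈ X) :
    ‖F x - F v - F' v (x - v)‖ ≤ L / 2 * ‖x - v‖ ^ 2 := by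
  set h := x - v with hh
  have hf (t : ℝ) : HasDerivAt (fun t : ℝ => F (v + t • h) - F v - t • F' v h)
      (F' (v + t • h) h - F' v h) t := by
    have h1 : HasDerivAt (fun t : ℝ => v + t • h) h t := by
      simpa using ((hasDerivAt_id t).smul_const h).const_add v
    have h2 : HasDerivAt (fun t : ℝ => t • F' v h) (F' v h) t := by
      simpa using (hasDerivAt_id t).smul_const (F' v h)
    exact (((hF' _).comp_hasDerivAt t h1).sub_const _).sub h2
  have hB (t : ℝ) : HasDerivAt (fun t : ℝ => L / 2 * ‖h‖ ^ 2 * t ^ 2)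
      (L * ‖h‖ ^ 2 * t) t := by
    refine ((hasDerivAt_pow 2 t).const_mul (L / 2 * ‖h‖ ^ 2)).congr_deriv ?_
    norm_num
    ring
  have key := image_norm_le_of_norm_deriv_right_le_deriv_boundary (a := 0) (b := 1)
    (fun t _ => (hf t).continuousAt.continuousWithinAt)
    (fun t _ => (hf t).hasDerivWithinAt) (by simp) hB
    (fun t ht => by
      have hmem : v + t • h ∈ X := hX.add_smul_sub_mem hv hx ⟨ht.1, ht.2.le⟩
      have h1 := hsmooth _ hmem _ hv
      rw [add_sub_cancel_left, norm_smul, Real.norm_of_nonneg ht.1] at h1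
      calc ‖F' (v + t • h) h - F' v h‖ = ‖(F' (v + t • h) - F' v) h‖ := rfl
        _ ≤ ‖F' (v + t • h) - F' v‖ * ‖h‖ := ContinuousLinearMap.le_opNorm _ _
        _ ≤ (L * (t * ‖h‖)) * ‖h‖ := by gcongr
        _ = L * ‖h‖ ^ 2 * t := by ring)
    (Set.right_mem_Icc.2 zero_le_one)
  simpa [hh] using key

theorem inner_sub_half_sq_norm_add (s x₀ v d : E) :
    ⟪s, v + d - x₀⟫ - 1 / 2 * ‖v + d - x₀‖ ^ 2 =
      ⟪s, v - x₀⟫ - 1 / 2 * ‖v - x₀‖ ^ 2 + ⟪s - (v - x₀), d⟫ - 1 / 2 * ‖d‖ ^ 2 := by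
  rw [add_sub_right_comm, norm_add_sq_real, inner_add_right, inner_sub_left s]
  ring

/-- A maximizer over a convex set of the strongly concave function
`w ↦ ⟪s, w - x₀⟫ - ‖w - x₀‖² / 2` satisfies the quadratic growth bound. -/
theorem inner_sub_half_sq_norm_le_of_isMax {X : Set E} (hX : Convex ℝ X) {s x₀ v : E}
    (hv : v ∈ X)
    (hmax : ∀ w ∈ X, ⟪s, w - x₀⟫ - 1 / 2 * ‖w - x₀‖ ^ 2 ≤
      ⟪s, v - x₀⟫ - 1 / 2 * ‖v - x₀‖ ^ 2) {w : E} (hw : w ∈ X) :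
    ⟪s, w - x₀⟫ - 1 / 2 * ‖w - x₀‖ ^ 2 ≤
      ⟪s, v - x₀⟫ - 1 / 2 * ‖v - x₀‖ ^ 2 - 1 / 2 * ‖w - v‖ ^ 2 := by
  have hopt : ⟪s - (v - x₀), w - v⟫ ≤ 0 := by
    by_contra! hA
    set A := ⟪s - (v - x₀), w - v⟫
    set D := ‖w - v‖ ^ 2 with hD
    have hD0 : 0 ≤ D := sq_nonneg _
    have ht0 : 0 < A / (A + D) := by positivity
    have ht1 : A / (A + D) ≤ 1 := (div_le_one (by positivity)).2 (by linarith)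
    have htA : A / (A + D) * (A + D) = A := div_mul_cancel₀ _ (by positivity)
    set t := A / (A + D)
    have h := hmax _ (hX.add_smul_sub_mem hv hw ⟨ht0.le, ht1⟩)
    rw [inner_sub_half_sq_norm_add, inner_smul_right, norm_smul, mul_pow,
      Real.norm_of_nonneg ht0.le, ← hD] at h
    have h2 : t * (A - 1 / 2 * (t * D)) ≤ 0 := by linarith
    have h3 : A - 1 / 2 * (t * D) ≤ 0 := nonpos_of_mul_nonpos_right h2 ht0
    nlinarith [mul_pos ht0 hA]
  have h := inner_sub_half_sq_norm_add s x₀ v (w - v)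
  rw [add_sub_cancel] at h
  linarith

theorem quadratic_step_bound {a : ℝ} (ha : 1 / 32 ≤ a) (ha' : a ≤ 1 / 22) (p q : E) :
    a * ‖p‖ ^ 2 + a * (‖p‖ * ‖q‖) - 10 * a * ⟪p, q⟫ - 1 / 2 * ‖q - p‖ ^ 2 ≤
      -(1 / 8) * ‖p‖ ^ 2 := by
  rw [norm_sub_sq_real, real_inner_comm p q]
  have h1 : (1 - 10 * a) * ⟪p, q⟫ ≤ (1 - 10 * a) * (‖p‖ * ‖q‖) :=
    mul_le_mul_of_nonneg_left (real_inner_le_norm p q) (by linarith)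
  have h2 : 81 / 2 * a ^ 2 - 8 * a + 1 / 8 ≤ 0 := by nlinarith
  nlinarith [sq_nonneg (‖q‖ - (1 - 9 * a) * ‖p‖),
    mul_nonneg (neg_nonneg.2 h2) (sq_nonneg ‖p‖)]

end Auxiliary

/-- descent lemma for VIJI with η = 10: with the Lyapunov function
`E_k = sup_{v ∈ X} { ⟪s_k, v − x_0⟫ − (1/2)‖v − x_0‖² }`, for every `T ≥ 1` and `x ∈ X`,
`∑_{k=1}^T λ_k ⟪F(x_k), x_k − x⟫ ≤ E_0 − E_T + ⟪s_T, x − x_0⟫ − (1/8)∑_{k=1}^T ‖x_k − v_k‖²`. -/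
theorem viji_descent_lemma
    (d : ℕ) (X : Set (EuclideanSpace ℝ (Fin d)))
    (hXconv : Convex ℝ X) (hXclosed : IsClosed X) (hXbdd : Bornology.IsBounded X)
    (F : EuclideanSpace ℝ (Fin d) → EuclideanSpace ℝ (Fin d))
    (F' : EuclideanSpace ℝ (Fin d) → EuclideanSpace ℝ (Fin d) →L[ℝ] EuclideanSpace ℝ (Fin d))
    (hF' : ∀ x, HasFDerivAt F (F' x) x)
    (L δ : ℝ)
    (hsmooth : ∀ x ∈ X, ∀ y ∈ X, ‖F' x - F' y‖ ≤ L * ‖x - y‖)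
    (J : EuclideanSpace ℝ (Fin d) → EuclideanSpace ℝ (Fin d) →L[ℝ] EuclideanSpace ℝ (Fin d))
    (hJ : ∀ v ∈ X, ‖F' v - J v‖ ≤ δ)
    (Ω : EuclideanSpace ℝ (Fin d) → EuclideanSpace ℝ (Fin d) → EuclideanSpace ℝ (Fin d))
    (hΩ : ∀ v x, Ω v x = F v + J v (x - v) + (10 * δ) • (x - v)
      + (5 * L * ‖x - v‖) • (x - v))
    (xs vs s : ℕ → EuclideanSpace ℝ (Fin d)) (lam : ℕ → ℝ)
    (hxsX : ∀ k, xs k ∈ X) (hvsX : ∀ k, vs k ∈ X)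
    (hs0 : s 0 = 0)
    (hlampos : ∀ k, 0 < lam k)
    (hvmax : ∀ k, ∀ w ∈ X,
      ⟪s k, w - xs 0⟫ - 1 / 2 * ‖w - xs 0‖ ^ 2 ≤
        ⟪s k, vs (k + 1) - xs 0⟫ - 1 / 2 * ‖vs (k + 1) - xs 0‖ ^ 2)
    (hsub : ∀ k, ∀ w ∈ X,
      ⟪Ω (vs (k + 1)) (xs (k + 1)), xs (k + 1) - w⟫ ≤
        L / 2 * ‖xs (k + 1) - vs (k + 1)‖ ^ 3 + δ * ‖xs (k + 1) - vs (k + 1)‖ ^ 2)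
    (hlam : ∀ k, 1 / 32 ≤ lam (k + 1) * (L / 2 * ‖xs (k + 1) - vs (k + 1)‖ + δ) ∧
      lam (k + 1) * (L / 2 * ‖xs (k + 1) - vs (k + 1)‖ + δ) ≤ 1 / 22)
    (hsrec : ∀ k, s (k + 1) = s k - lam (k + 1) • F (xs (k + 1)))
    (Efun : ℕ → ℝ)
    (hE : ∀ k, Efun k =
      sSup ((fun w => ⟪s k, w - xs 0⟫ - 1 / 2 * ‖w - xs 0‖ ^ 2) '' X)) :
    ∀ T : ℕ, 1 ≤ T → ∀ x ∈ X,
      ∑ k ∈ Finset.Icc 1 T, lam k * ⟪F (xs k), xs k - x⟫ ≤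
        Efun 0 - Efun T + ⟪s T, x - xs 0⟫
          - 1 / 8 * ∑ k ∈ Finset.Icc 1 T, ‖xs k - vs k‖ ^ 2 := by
  have hEeq (k : ℕ) : Efun k =
      ⟪s k, vs (k + 1) - xs 0⟫ - 1 / 2 * ‖vs (k + 1) - xs 0‖ ^ 2 := by
    rw [hE]
    refine IsGreatest.csSup_eq ⟨⟨_, hvsX (k + 1), rfl⟩, ?_⟩
    rintro _ ⟨w, hw, rfl⟩
    exact hvmax k w hw
  have hstep (k : ℕ) : lam (k + 1) * ⟪F (xs (k + 1)), xs (k + 1) - xs 0⟫ ≤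
      Efun k - Efun (k + 1) - 1 / 8 * ‖xs (k + 1) - vs (k + 1)‖ ^ 2 := by
    have hgrow := inner_sub_half_sq_norm_le_of_isMax hXconv (hvsX (k + 1)) (hvmax k)
      (hvsX (k + 2))
    have hgap := hsub k _ (hvsX (k + 2))
    obtain ⟨hlo, hhi⟩ := hlam k
    have htaylor := norm_image_sub_sub_fderiv_le hXconv hF' hsmooth (hvsX (k + 1))
      (hxsX (k + 1))
    have hjac := ((F' (vs (k + 1)) - J (vs (k + 1))).le_opNorm
      (xs (k + 1) - vs (k + 1))).trans
      (mul_le_mul_of_nonneg_right (hJ _ (hvsX (k + 1))) (norm_nonneg _))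
    have hl := hlampos (k + 1)
    have hinner : ⟪F (xs (k + 1)), xs (k + 1) - vs (k + 2)⟫ =
        ⟪F (xs (k + 1)), xs (k + 1) - xs 0⟫ - ⟪F (xs (k + 1)), vs (k + 2) - xs 0⟫ := by
      rw [← inner_sub_right, sub_sub_sub_cancel_right]
    have hE₁ := hEeq (k + 1)
    rw [hsrec, inner_sub_left, real_inner_smul_left] at hE₁
    have hE₀ := hEeq k
    have hdiff : vs (k + 2) - vs (k + 1) =
        -((xs (k + 1) - vs (k + 2)) - (xs (k + 1) - vs (k + 1))) := by abel
    rw [hdiff, norm_neg] at hgrow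
    have hquad := quadratic_step_bound hlo hhi (xs (k + 1) - vs (k + 1))
      (xs (k + 1) - vs (k + 2))
    set p := xs (k + 1) - vs (k + 1)
    set q := xs (k + 1) - vs (k + 2)
    set c := L / 2 * ‖p‖ + δ with hc
    set e := F (xs (k + 1)) - F (vs (k + 1)) - F' (vs (k + 1)) p +
      (F' (vs (k + 1)) - J (vs (k + 1))) p with he
    have herr : ‖e‖ ≤ c * ‖p‖ := by
      refine (norm_add_le_of_le htaylor hjac).trans_eq ?_
      rw [hc]; ring
    have hdecomp : F (xs (k + 1)) = Ω (vs (k + 1)) (xs (k + 1)) - (10 * c) • p + e := by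
      rw [hΩ, he, hc, sub_apply]
      module
    have hFq : ⟪F (xs (k + 1)), q⟫ ≤
        c * ‖p‖ ^ 2 - 10 * c * ⟪p, q⟫ + c * ‖p‖ * ‖q‖ := by
      have h1 : ⟪e, q⟫ ≤ c * ‖p‖ * ‖q‖ :=
        (real_inner_le_norm e q).trans (mul_le_mul_of_nonneg_right herr (norm_nonneg _))
      have h2 : L / 2 * ‖p‖ ^ 3 + δ * ‖p‖ ^ 2 = c * ‖p‖ ^ 2 := by rw [hc]; ring
      rw [hdecomp, inner_add_left, inner_sub_left, real_inner_smul_left]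
      linarith
    have hscaled := mul_le_mul_of_nonneg_left hFq hl.le
    rw [hinner] at hscaled
    linarith
  have hsum (T : ℕ) (x : EuclideanSpace ℝ (Fin d)) :
      ∑ k ∈ Finset.Icc 1 T, lam k * ⟪F (xs k), xs k - x⟫ ≤
        Efun 0 - Efun T + ⟪s T, x - xs 0⟫
          - 1 / 8 * ∑ k ∈ Finset.Icc 1 T, ‖xs k - vs k‖ ^ 2 := by
    induction T with
    | zero => simp [hs0]
    | succ T ih =>
      rw [Finset.sum_Icc_succ_top (by omega), Finset.sum_Icc_succ_top (by omega), hsrec,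
        inner_sub_left, real_inner_smul_left]
      have h1 : ⟪F (xs (T + 1)), xs (T + 1) - x⟫ =
          ⟪F (xs (T + 1)), xs (T + 1) - xs 0⟫ - ⟪F (xs (T + 1)), x - xs 0⟫ := by
        rw [← inner_sub_right, sub_sub_sub_cancel_right]
      rw [h1]
      linarith [hstep T]
  exact fun T _ x _ => hsum T x
end

section
/- Let X, F, J, δ, L and the VIJI iterates (x_k, v_k, s_k, λ_k) with η = 10 be as in the context, and assume additionally that F satisfies the Minty condition on X with point x*. Then for every integer T ≥ 1: (i) for all x ∈ X, ∑_{k=1}^T λ_k ⟨F(x_k), x_k − x⟩ + (1/8) ∑_{k=1}^T ∥x_k − v_k∥² ≤ (1/2)∥x − x_0∥², and (ii) ∑_{k=1}^T ∥x_k − v_k∥² ≤ 4∥x* − x_0∥². -/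
open scoped RealInnerProductSpace

section Auxiliary

variable {E : Type*} [NormedAddCommGroup E] [InnerProductSpace ℝ E]

/-- Second-order Taylor bound along a segment on which the derivative is Lipschitz. -/
theorem norm_sub_sub_fderiv_le_of_lipschitz {G : Type*} [NormedAddCommGroup G] [NormedSpace ℝ G]
    {X : Set E} (hX : Convex ℝ X) {F : E → G} {F' : E → E →L[ℝ] G}
    (hF' : ∀ x, HasFDerivAt F (F' x) x) {L : ℝ}
    (hL : ∀ x ∈ X, ∀ y ∈ X, ‖F' x - F' y‖ ≤ L * ‖x - y‖) {v x : E} (hv : v ∈ X) (hx : x ∈ X) :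
    ‖F x - F v - F' v (x - v)‖ ≤ L / 2 * ‖x - v‖ ^ 2 := by
  set p := x - v with hp
  have hline (t : ℝ) : HasDerivAt (fun t : ℝ => v + t • p) p t := by
    simpa using ((hasDerivAt_id t).smul_const p).const_add v
  have hg (t : ℝ) : HasDerivAt (fun t : ℝ => F (v + t • p) - F v - t • F' v p)
      (F' (v + t • p) p - F' v p) t := by
    have h1 := (hF' (v + t • p)).comp_hasDerivAt t (hline t)
    have h2 : HasDerivAt (fun t : ℝ => t • F' v p) (F' v p) t := by
      simpa using (hasDerivAt_id t).smul_const (F' v p)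
    exact (h1.sub_const (F v)).sub h2
  have hB (t : ℝ) : HasDerivAt (fun t : ℝ => L / 2 * ‖p‖ ^ 2 * t ^ 2) (L * ‖p‖ ^ 2 * t) t :=
    ((hasDerivAt_pow 2 t).const_mul (L / 2 * ‖p‖ ^ 2)).congr_deriv (by norm_num; ring)
  have key := image_norm_le_of_norm_deriv_right_le_deriv_boundary (a := 0) (b := 1)
    (f := fun t : ℝ => F (v + t • p) - F v - t • F' v p)
    (f' := fun t => F' (v + t • p) p - F' v p)
    (fun t _ => (hg t).continuousAt.continuousWithinAt)
    (fun t _ => (hg t).hasDerivWithinAt)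
    (B := fun t : ℝ => L / 2 * ‖p‖ ^ 2 * t ^ 2) (B' := fun t => L * ‖p‖ ^ 2 * t)
    (by simp) hB
    (fun t ht => by
      have hmem : v + t • p ∈ X := hX.add_smul_sub_mem hv hx ⟨ht.1, ht.2.le⟩
      have h := hL _ hmem _ hv
      rw [add_sub_cancel_left, norm_smul, Real.norm_of_nonneg ht.1] at h
      calc ‖F' (v + t • p) p - F' v p‖ = ‖(F' (v + t • p) - F' v) p‖ := by simp
        _ ≤ ‖F' (v + t • p) - F' v‖ * ‖p‖ := ContinuousLinearMap.le_opNorm _ _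
        _ ≤ L * (t * ‖p‖) * ‖p‖ := by gcongr
        _ = L * ‖p‖ ^ 2 * t := by ring)
    (Set.right_mem_Icc.2 zero_le_one)
  simpa [hp] using key

/-- The maximizer over a convex set of a 1-strongly concave quadratic has quadratic growth. -/
theorem inner_sub_half_norm_sq_add_le_of_isMax {X : Set E} (hX : Convex ℝ X) {s x₀ v : E}
    (hv : v ∈ X)
    (hmax : ∀ w ∈ X, ⟪s, w - x₀⟫ - 1 / 2 * ‖w - x₀‖ ^ 2 ≤ ⟪s, v - x₀⟫ - 1 / 2 * ‖v - x₀‖ ^ 2)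
    {w : E} (hw : w ∈ X) :
    ⟪s, w - x₀⟫ - 1 / 2 * ‖w - x₀‖ ^ 2 + 1 / 2 * ‖w - v‖ ^ 2 ≤
      ⟪s, v - x₀⟫ - 1 / 2 * ‖v - x₀‖ ^ 2 := by
  have expand (t : ℝ) : ⟪s, v + t • (w - v) - x₀⟫ - 1 / 2 * ‖v + t • (w - v) - x₀‖ ^ 2 =
      ⟪s, v - x₀⟫ - 1 / 2 * ‖v - x₀‖ ^ 2 + t * ⟪s - (v - x₀), w - v⟫
        - t ^ 2 / 2 * ‖w - v‖ ^ 2 := by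
    rw [show v + t • (w - v) - x₀ = (v - x₀) + t • (w - v) by abel, norm_add_sq_real,
      inner_add_right, inner_smul_right, inner_smul_right,
      inner_sub_left s (v - x₀), norm_smul, mul_pow,
      Real.norm_eq_abs, sq_abs]
    ring
  have hle : ⟪s - (v - x₀), w - v⟫ ≤ 0 := by
    by_contra! ha
    set a := ⟪s - (v - x₀), w - v⟫
    set N := ‖w - v‖ ^ 2
    have hN : 0 ≤ N := by positivity
    have ht : 0 < a / (a + N) := by positivity
    have ht1 : a / (a + N) ≤ 1 := (div_le_one (by positivity)).2 (by linarith)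
    have h := hmax _ (hX.add_smul_sub_mem hv hw ⟨ht.le, ht1⟩)
    rw [expand] at h
    have h2 : a / (a + N) * (a + N) = a := div_mul_cancel₀ _ (by positivity)
    set t := a / (a + N)
    have h3 : 0 ≤ t * (t * N / 2 - a) := by linarith
    have h4 : 0 ≤ t * N / 2 - a := nonneg_of_mul_nonneg_right h3 ht
    nlinarith [mul_pos ht ha]
  have h1 := expand 1
  rw [one_smul, add_sub_cancel] at h1
  linarith

/-- One step of the potential argument: the gain of an inexact second-order step pays for
`1 / 8` of the squared step length. -/
theorem viji_step {X : Set E} (hX : Convex ℝ X) {F : E → E} {F' J : E → E →L[ℝ] E}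
    (hF' : ∀ x, HasFDerivAt F (F' x) x) {L δ l : ℝ}
    (hL : ∀ x ∈ X, ∀ y ∈ X, ‖F' x - F' y‖ ≤ L * ‖x - y‖)
    (hJ : ∀ v ∈ X, ‖F' v - J v‖ ≤ δ) {x v w : E} (hx : x ∈ X) (hv : v ∈ X) (hl : 0 < l)
    (hsub : ⟪F v + J v (x - v) + (10 * δ) • (x - v) + (5 * L * ‖x - v‖) • (x - v), x - w⟫ ≤
      L / 2 * ‖x - v‖ ^ 3 + δ * ‖x - v‖ ^ 2)
    (hlow : 1 / 32 ≤ l * (L / 2 * ‖x - v‖ + δ)) (hup : l * (L / 2 * ‖x - v‖ + δ) ≤ 1 / 22) :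
    l * ⟪F x, x - w⟫ + 1 / 8 * ‖x - v‖ ^ 2 ≤ 1 / 2 * ‖w - v‖ ^ 2 := by
  have htaylor := norm_sub_sub_fderiv_le_of_lipschitz hX hF' hL hv hx
  have hJerr : ‖(F' v - J v) (x - v)‖ ≤ δ * ‖x - v‖ :=
    ((F' v - J v).le_opNorm _).trans (by gcongr; exact hJ v hv)
  rw [show w - v = (x - v) - (x - w) by abel, norm_sub_sq_real (x - v) (x - w)]
  have hdecomp : F x = (F v + J v (x - v) + (10 * δ) • (x - v) + (5 * L * ‖x - v‖) • (x - v))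
      + ((F x - F v - F' v (x - v)) + (F' v - J v) (x - v))
      - (10 * (L / 2 * ‖x - v‖ + δ)) • (x - v) := by
    rw [sub_apply]
    module
  have hmodel : ‖(F x - F v - F' v (x - v)) + (F' v - J v) (x - v)‖ ≤
      (L / 2 * ‖x - v‖ + δ) * ‖x - v‖ := by
    refine (norm_add_le _ _).trans ?_
    linarith
  have herr := (real_inner_le_norm ((F x - F v - F' v (x - v)) + (F' v - J v) (x - v))
    (x - w)).trans (mul_le_mul_of_nonneg_right hmodel (norm_nonneg _))
  have hF : ⟪F x, x - w⟫ ≤ L / 2 * ‖x - v‖ ^ 3 + δ * ‖x - v‖ ^ 2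
      + (L / 2 * ‖x - v‖ + δ) * ‖x - v‖ * ‖x - w‖
      - 10 * (L / 2 * ‖x - v‖ + δ) * ⟪x - v, x - w⟫ := by
    rw [hdecomp, inner_sub_left, inner_add_left, real_inner_smul_left]
    linarith
  have hpq := real_inner_le_norm (x - v) (x - w)
  have hlF := mul_le_mul_of_nonneg_left hF hl.le
  set r := ‖x - v‖
  set D := ‖x - w‖
  set i := ⟪x - v, x - w⟫
  set c := l * (L / 2 * r + δ) with hc
  have hlF' : l * ⟪F x, x - w⟫ ≤ c * r ^ 2 + c * (r * D) - 10 * c * i := by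
    rw [hc]
    linarith
  have hi : (1 - 10 * c) * i ≤ (1 - 10 * c) * (r * D) :=
    mul_le_mul_of_nonneg_left hpq (by linarith)
  have hcr : 0 ≤ (3 / 8 - c - 1 / 2 * (1 - 9 * c) ^ 2) * r ^ 2 :=
    mul_nonneg (by nlinarith) (sq_nonneg r)
  linarith [sq_nonneg ((1 - 9 * c) * r - D)]

end Auxiliary

/-- Lemma on error bounds for VIJI with η = 10 under the Minty condition:
(i) `∑ λ_k ⟪F(x_k), x_k − x⟫ + (1/8)∑ ‖x_k − v_k‖² ≤ (1/2)‖x − x_0‖²` for all `x ∈ X`, and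
(ii) `∑ ‖x_k − v_k‖² ≤ 4‖x* − x_0‖²`. -/
theorem viji_error_bounds
    (d : ℕ) (X : Set (EuclideanSpace ℝ (Fin d)))
    (hXconv : Convex ℝ X) (hXclosed : IsClosed X) (hXbdd : Bornology.IsBounded X)
    (F : EuclideanSpace ℝ (Fin d) → EuclideanSpace ℝ (Fin d))
    (F' : EuclideanSpace ℝ (Fin d) → EuclideanSpace ℝ (Fin d) →L[ℝ] EuclideanSpace ℝ (Fin d))
    (hF' : ∀ x, HasFDerivAt F (F' x) x)
    (L δ : ℝ)
    (hsmooth : ∀ x ∈ X, ∀ y ∈ X, ‖F' x - F' y‖ ≤ L * ‖x - y‖)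
    (J : EuclideanSpace ℝ (Fin d) → EuclideanSpace ℝ (Fin d) →L[ℝ] EuclideanSpace ℝ (Fin d))
    (hJ : ∀ v ∈ X, ‖F' v - J v‖ ≤ δ)
    (Ω : EuclideanSpace ℝ (Fin d) → EuclideanSpace ℝ (Fin d) → EuclideanSpace ℝ (Fin d))
    (hΩ : ∀ v x, Ω v x = F v + J v (x - v) + (10 * δ) • (x - v)
      + (5 * L * ‖x - v‖) • (x - v))
    (xs vs s : ℕ → EuclideanSpace ℝ (Fin d)) (lam : ℕ → ℝ)
    (hxsX : ∀ k, xs k ∈ X) (hvsX : ∀ k, vs k ∈ X)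
    (hs0 : s 0 = 0)
    (hlampos : ∀ k, 0 < lam k)
    (hvmax : ∀ k, ∀ w ∈ X,
      ⟪s k, w - xs 0⟫ - 1 / 2 * ‖w - xs 0‖ ^ 2 ≤
        ⟪s k, vs (k + 1) - xs 0⟫ - 1 / 2 * ‖vs (k + 1) - xs 0‖ ^ 2)
    (hsub : ∀ k, ∀ w ∈ X,
      ⟪Ω (vs (k + 1)) (xs (k + 1)), xs (k + 1) - w⟫ ≤
        L / 2 * ‖xs (k + 1) - vs (k + 1)‖ ^ 3 + δ * ‖xs (k + 1) - vs (k + 1)‖ ^ 2)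
    (hlam : ∀ k, 1 / 32 ≤ lam (k + 1) * (L / 2 * ‖xs (k + 1) - vs (k + 1)‖ + δ) ∧
      lam (k + 1) * (L / 2 * ‖xs (k + 1) - vs (k + 1)‖ + δ) ≤ 1 / 22)
    (hsrec : ∀ k, s (k + 1) = s k - lam (k + 1) • F (xs (k + 1)))
    (xstar : EuclideanSpace ℝ (Fin d)) (hxstarX : xstar ∈ X)
    (hminty : ∀ x ∈ X, 0 ≤ ⟪F x, x - xstar⟫) :
    ∀ T : ℕ, 1 ≤ T →
      (∀ x ∈ X,
        ∑ k ∈ Finset.Icc 1 T, lam k * ⟪F (xs k), xs k - x⟫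
            + 1 / 8 * ∑ k ∈ Finset.Icc 1 T, ‖xs k - vs k‖ ^ 2 ≤
          1 / 2 * ‖x - xs 0‖ ^ 2) ∧
      ∑ k ∈ Finset.Icc 1 T, ‖xs k - vs k‖ ^ 2 ≤ 4 * ‖xstar - xs 0‖ ^ 2 := by
  have hpot (T : ℕ) : ∑ k ∈ Finset.Icc 1 T, lam k * ⟪F (xs k), xs k - xs 0⟫
      + 1 / 8 * ∑ k ∈ Finset.Icc 1 T, ‖xs k - vs k‖ ^ 2
      + (⟪s T, vs (T + 1) - xs 0⟫ - 1 / 2 * ‖vs (T + 1) - xs 0‖ ^ 2) ≤ 0 := by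
    induction T with
    | zero =>
      simp only [hs0, inner_zero_left, Finset.Icc_eq_empty_of_lt zero_lt_one, Finset.sum_empty]
      linarith [sq_nonneg ‖vs (0 + 1) - xs 0‖]
    | succ T ih =>
      rw [Finset.sum_Icc_succ_top (by omega), Finset.sum_Icc_succ_top (by omega)]
      have hgrow := inner_sub_half_norm_sq_add_le_of_isMax hXconv (hvsX (T + 1)) (hvmax T)
        (hvsX (T + 1 + 1))
      have hs := hsub T _ (hvsX (T + 1 + 1))
      rw [hΩ] at hs
      have hstep := viji_step hXconv hF' hsmooth hJ (hxsX (T + 1)) (hvsX (T + 1))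
        (hlampos (T + 1)) hs (hlam T).1 (hlam T).2
      rw [← sub_sub_sub_cancel_right (xs (T + 1)) (vs (T + 1 + 1)) (xs 0), inner_sub_right]
        at hstep
      rw [hsrec, inner_sub_left, real_inner_smul_left]
      linarith
  have hdual (x : EuclideanSpace ℝ (Fin d)) (T : ℕ) :
      ∑ k ∈ Finset.Icc 1 T, lam k * ⟪F (xs k), xs k - x⟫ =
        ∑ k ∈ Finset.Icc 1 T, lam k * ⟪F (xs k), xs k - xs 0⟫ + ⟪s T, x - xs 0⟫ := by
    induction T with
    | zero => simp [hs0]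
    | succ T ih =>
      rw [Finset.sum_Icc_succ_top (by omega), Finset.sum_Icc_succ_top (by omega), ih, hsrec,
        inner_sub_left, real_inner_smul_left,
        ← sub_sub_sub_cancel_right (xs (T + 1)) x (xs 0), inner_sub_right _ _ (x - xs 0)]
      ring
  intro T _
  have hbound : ∀ x ∈ X, ∑ k ∈ Finset.Icc 1 T, lam k * ⟪F (xs k), xs k - x⟫
      + 1 / 8 * ∑ k ∈ Finset.Icc 1 T, ‖xs k - vs k‖ ^ 2 ≤ 1 / 2 * ‖x - xs 0‖ ^ 2 := by
    intro x hx
    rw [hdual x T]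
    linarith [hpot T, hvmax T x hx]
  refine ⟨hbound, ?_⟩
  have hnonneg : 0 ≤ ∑ k ∈ Finset.Icc 1 T, lam k * ⟪F (xs k), xs k - xstar⟫ :=
    Finset.sum_nonneg fun k _ => mul_nonneg (hlampos k).le (hminty _ (hxsX k))
  linarith [hbound xstar hxstarX]
end

section
/- Let X, F, J, δ, L and the VIJI iterates (x_k, v_k, s_k, λ_k) with η = 10 be as in the context, and assume F satisfies the Minty condition on X with point x*. Then for every integer T ≥ 1, the dual step sizes satisfy 1/(∑_{k=1}^T λ_k)² ≤ 2048 L² ∥x* − x_0∥² / T³ + 2048 δ² / T². -/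
open scoped RealInnerProductSpace

/-- Strong concavity of the proximal objective at its maximizer over a convex set. -/
theorem Convex.prox_objective_le_of_isMax {E : Type*} [NormedAddCommGroup E]
    [InnerProductSpace ℝ E] {X : Set E} (hX : Convex ℝ X) {s c v : E} (hv : v ∈ X)
    (hmax : ∀ w ∈ X, ⟪s, w - c⟫ - 1 / 2 * ‖w - c‖ ^ 2 ≤ ⟪s, v - c⟫ - 1 / 2 * ‖v - c‖ ^ 2)
    {w : E} (hw : w ∈ X) :
    ⟪s, w - c⟫ - 1 / 2 * ‖w - c‖ ^ 2 ≤
      ⟪s, v - c⟫ - 1 / 2 * ‖v - c‖ ^ 2 - 1 / 2 * ‖v - w‖ ^ 2 := by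
  have expand (t : ℝ) : ⟪s, v + t • (w - v) - c⟫ - 1 / 2 * ‖v + t • (w - v) - c‖ ^ 2 =
      ⟪s, v - c⟫ - 1 / 2 * ‖v - c‖ ^ 2 + t * ⟪s - (v - c), w - v⟫
        - t ^ 2 / 2 * ‖w - v‖ ^ 2 := by
    have h : v + t • (w - v) - c = (v - c) + t • (w - v) := by abel
    rw [h, norm_add_sq_real, norm_smul, mul_pow, Real.norm_eq_abs, sq_abs, inner_add_right,
      inner_smul_right, inner_smul_right, inner_sub_left s]
    ring
  have hA : ⟪s - (v - c), w - v⟫ ≤ 0 := by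
    by_contra! hpos
    set A := ⟪s - (v - c), w - v⟫
    have hB : 0 ≤ ‖w - v‖ ^ 2 := sq_nonneg _
    set B := ‖w - v‖ ^ 2
    have hAB : 0 < A + B := by linarith
    have ht : 0 < A / (A + B) := div_pos hpos hAB
    have h := hmax _ (hX.add_smul_sub_mem hv hw
      ⟨ht.le, (div_le_one hAB).2 (by linarith)⟩)
    rw [expand] at h
    have hmul : A / (A + B) * (A + B) = A := div_mul_cancel₀ _ hAB.ne'
    nlinarith
  have h := expand 1
  rw [one_smul, add_sub_cancel] at h
  rw [h, norm_sub_rev v w]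
  linarith

/-- First-order Taylor bound for a map whose derivative is Lipschitz on a convex set. -/
theorem Convex.norm_taylor_one_le {E G : Type*} [NormedAddCommGroup E] [NormedSpace ℝ E]
    [NormedAddCommGroup G] [NormedSpace ℝ G] {X : Set E} (hX : Convex ℝ X) {F : E → G}
    {F' : E → E →L[ℝ] G} (hF' : ∀ x, HasFDerivAt F (F' x) x) {L : ℝ}
    (hsmooth : ∀ x ∈ X, ∀ y ∈ X, ‖F' x - F' y‖ ≤ L * ‖x - y‖) {x v : E} (hx : x ∈ X)
    (hv : v ∈ X) :
    ‖F x - F v - F' v (x - v)‖ ≤ L / 2 * ‖x - v‖ ^ 2 := by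
  have hg (t : ℝ) : HasDerivAt (fun t : ℝ => F (v + t • (x - v)) - F v - t • F' v (x - v))
      ((F' (v + t • (x - v)) - F' v) (x - v)) t := by
    have hline : HasDerivAt (fun t : ℝ => v + t • (x - v)) (x - v) t := by
      simpa using ((hasDerivAt_id t).smul_const (x - v)).const_add v
    have h := (((hF' (v + t • (x - v))).comp_hasDerivAt t hline).sub_const (F v)).sub
      ((hasDerivAt_id t).smul_const (F' v (x - v)))
    rw [one_smul, ← sub_apply] at h
    exact h
  have hB (t : ℝ) : HasDerivAt (fun t : ℝ => L / 2 * ‖x - v‖ ^ 2 * t ^ 2)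
      (L * ‖x - v‖ ^ 2 * t) t := by
    have h := (hasDerivAt_pow 2 t).const_mul (L / 2 * ‖x - v‖ ^ 2)
    exact h.congr_deriv (by push_cast; ring)
  have key := image_norm_le_of_norm_deriv_right_le_deriv_boundary
    (a := 0) (b := 1) (fun t _ => (hg t).continuousAt.continuousWithinAt)
    (fun t _ => (hg t).hasDerivWithinAt) (by simp) hB
    (fun t ht => by
      have hm : v + t • (x - v) ∈ X := hX.add_smul_sub_mem hv hx ⟨ht.1, ht.2.le⟩
      have h1 := hsmooth _ hm _ hv
      rw [add_sub_cancel_left, norm_smul, Real.norm_of_nonneg ht.1] at h1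
      calc _ ≤ ‖F' (v + t • (x - v)) - F' v‖ * ‖x - v‖ := ContinuousLinearMap.le_opNorm _ _
        _ ≤ L * (t * ‖x - v‖) * ‖x - v‖ := by gcongr
        _ = _ := by ring)
    (Set.right_mem_Icc.2 zero_le_one)
  simpa using key

/-- If `λ k * a k ≥ 1 / 32`, the reciprocal squared sum of `λ` is controlled by `∑ a k ^ 2`. -/
theorem Finset.one_div_sum_sq_le {ι : Type*} (S : Finset ι) (hS : S.Nonempty) (lam a : ι → ℝ)
    (hlam : ∀ k ∈ S, 0 < lam k) (h : ∀ k ∈ S, 1 / 32 ≤ lam k * a k) :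
    1 / (∑ k ∈ S, lam k) ^ 2 ≤ 1024 * (∑ k ∈ S, a k ^ 2) / (S.card : ℝ) ^ 3 := by
  have hc : 0 < (S.card : ℝ) := by exact_mod_cast hS.card_pos
  have hl : 0 < ∑ k ∈ S, lam k := Finset.sum_pos hlam hS
  have ha : ∀ k ∈ S, 0 < a k := fun k hk =>
    pos_of_mul_pos_right (by linarith [h k hk]) (hlam k hk).le
  have hcs : (S.card : ℝ) ^ 2 / 32 ≤ (∑ k ∈ S, lam k) * ∑ k ∈ S, a k := by
    have h1 := Finset.sum_sq_le_sum_mul_sum_of_sq_le_mul S (r := fun _ => (1 : ℝ))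
      (f := fun k => 32 * lam k) (g := a) (fun k hk => by have := hlam k hk; positivity)
      (fun k hk => (ha k hk).le) (fun k hk => by have := h k hk; linarith)
    rw [Finset.sum_const, nsmul_eq_mul, mul_one, ← Finset.mul_sum] at h1
    linarith
  have hsq : (∑ k ∈ S, a k) ^ 2 ≤ S.card * ∑ k ∈ S, a k ^ 2 := sq_sum_le_card_mul_sum_sq
  have hcs2 : ((S.card : ℝ) ^ 2 / 32) ^ 2 ≤ ((∑ k ∈ S, lam k) * ∑ k ∈ S, a k) ^ 2 := by
    gcongr
  have hmul : ((∑ k ∈ S, lam k) * ∑ k ∈ S, a k) ^ 2 ≤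
      (∑ k ∈ S, lam k) ^ 2 * (S.card * ∑ k ∈ S, a k ^ 2) := by
    rw [mul_pow]
    gcongr
  rw [div_le_div_iff₀ (by positivity) (by positivity)]
  refine le_of_mul_le_mul_left ?_ hc
  nlinarith

/-- One-step bound for an extragradient-type step: `a` is the local model error and
`x` solves the regularized model up to `a * ‖x - v‖ ^ 2`. -/
theorem mul_inner_le_of_inexact_model {E : Type*} [NormedAddCommGroup E]
    [InnerProductSpace ℝ E] {f m x v w : E} {a l : ℝ} (hl : 0 < l)
    (hlo : 1 / 32 ≤ l * a) (hhi : l * a ≤ 1 / 22) (hm : ‖f - m‖ ≤ a * ‖x - v‖)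
    (hsub : ⟪m + (10 * a) • (x - v), x - w⟫ ≤ a * ‖x - v‖ ^ 2) :
    l * ⟪f, x - w⟫ ≤ 1 / 2 * ‖v - w‖ ^ 2 - 1 / 8 * ‖x - v‖ ^ 2 := by
  have ha : 0 < a := pos_of_mul_pos_right (by linarith) hl.le
  have hxw : x - w = (x - v) + (v - w) := by abel
  have h1 : ⟪f - m, x - w⟫ ≤ a * ‖x - v‖ * (‖x - v‖ + ‖v - w‖) := by
    refine (real_inner_le_norm _ _).trans ?_
    gcongr
    rw [hxw]
    exact norm_add_le _ _
  have h2 : ‖x - v‖ ^ 2 - ‖x - v‖ * ‖v - w‖ ≤ ⟪x - v, x - w⟫ := by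
    have h := (abs_le.1 (abs_real_inner_le_norm (x - v) (v - w))).1
    rw [hxw, inner_add_right, real_inner_self_eq_norm_sq]
    linarith
  rw [inner_add_left, real_inner_smul_left] at hsub
  rw [inner_sub_left] at h1
  have hr := norm_nonneg (x - v)
  have hD := norm_nonneg (v - w)
  set r := ‖x - v‖
  set D := ‖v - w‖
  have h3 : ⟪f, x - w⟫ ≤ a * (11 * (r * D) - 8 * r ^ 2) := by
    have := mul_le_mul_of_nonneg_left h2 ha.le
    nlinarith
  have h4 : l * ⟪f, x - w⟫ ≤ l * a * (11 * (r * D) - 8 * r ^ 2) := by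
    rw [mul_assoc]
    gcongr
  have h5 : l * a * (r * D) ≤ 1 / 22 * (r * D) := by gcongr
  have h6 : 1 / 32 * r ^ 2 ≤ l * a * r ^ 2 := by gcongr
  nlinarith [sq_nonneg (r - 2 * D)]



/-- dual step-size control for VIJI with η = 10 under the Minty condition:
`1/(∑_{k=1}^T λ_k)² ≤ 2048 L² ‖x* − x_0‖² / T³ + 2048 δ² / T²` for every `T ≥ 1`. -/
theorem viji_stepsize_control
    (d : ℕ) (X : Set (EuclideanSpace ℝ (Fin d)))
    (hXconv : Convex ℝ X) (hXclosed : IsClosed X) (hXbdd : Bornology.IsBounded X)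
    (F : EuclideanSpace ℝ (Fin d) → EuclideanSpace ℝ (Fin d))
    (F' : EuclideanSpace ℝ (Fin d) → EuclideanSpace ℝ (Fin d) →L[ℝ] EuclideanSpace ℝ (Fin d))
    (hF' : ∀ x, HasFDerivAt F (F' x) x)
    (L δ : ℝ)
    (hsmooth : ∀ x ∈ X, ∀ y ∈ X, ‖F' x - F' y‖ ≤ L * ‖x - y‖)
    (J : EuclideanSpace ℝ (Fin d) → EuclideanSpace ℝ (Fin d) →L[ℝ] EuclideanSpace ℝ (Fin d))
    (hJ : ∀ v ∈ X, ‖F' v - J v‖ ≤ δ)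
    (Ω : EuclideanSpace ℝ (Fin d) → EuclideanSpace ℝ (Fin d) → EuclideanSpace ℝ (Fin d))
    (hΩ : ∀ v x, Ω v x = F v + J v (x - v) + (10 * δ) • (x - v)
      + (5 * L * ‖x - v‖) • (x - v))
    (xs vs s : ℕ → EuclideanSpace ℝ (Fin d)) (lam : ℕ → ℝ)
    (hxsX : ∀ k, xs k ∈ X) (hvsX : ∀ k, vs k ∈ X)
    (hs0 : s 0 = 0)
    (hlampos : ∀ k, 0 < lam k)
    (hvmax : ∀ k, ∀ w ∈ X,
      ⟪s k, w - xs 0⟫ - 1 / 2 * ‖w - xs 0‖ ^ 2 ≤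
        ⟪s k, vs (k + 1) - xs 0⟫ - 1 / 2 * ‖vs (k + 1) - xs 0‖ ^ 2)
    (hsub : ∀ k, ∀ w ∈ X,
      ⟪Ω (vs (k + 1)) (xs (k + 1)), xs (k + 1) - w⟫ ≤
        L / 2 * ‖xs (k + 1) - vs (k + 1)‖ ^ 3 + δ * ‖xs (k + 1) - vs (k + 1)‖ ^ 2)
    (hlam : ∀ k, 1 / 32 ≤ lam (k + 1) * (L / 2 * ‖xs (k + 1) - vs (k + 1)‖ + δ) ∧
      lam (k + 1) * (L / 2 * ‖xs (k + 1) - vs (k + 1)‖ + δ) ≤ 1 / 22)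
    (hsrec : ∀ k, s (k + 1) = s k - lam (k + 1) • F (xs (k + 1)))
    (xstar : EuclideanSpace ℝ (Fin d)) (hxstarX : xstar ∈ X)
    (hminty : ∀ x ∈ X, 0 ≤ ⟪F x, x - xstar⟫) :
    ∀ T : ℕ, 1 ≤ T →
      1 / (∑ k ∈ Finset.Icc 1 T, lam k) ^ 2 ≤
        2048 * L ^ 2 * ‖xstar - xs 0‖ ^ 2 / (T : ℝ) ^ 3 + 2048 * δ ^ 2 / (T : ℝ) ^ 2 := by
  intro T hT
  have herr (k : ℕ) : ‖F (xs (k + 1)) - (F (vs (k + 1)) + J (vs (k + 1)) (xs (k + 1) - vs (k + 1)))‖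
      ≤ (L / 2 * ‖xs (k + 1) - vs (k + 1)‖ + δ) * ‖xs (k + 1) - vs (k + 1)‖ := by
    have h1 := hXconv.norm_taylor_one_le hF' hsmooth (hxsX (k + 1)) (hvsX (k + 1))
    have h2 := (F' (vs (k + 1)) - J (vs (k + 1))).le_of_opNorm_le (hJ _ (hvsX (k + 1)))
      (xs (k + 1) - vs (k + 1))
    rw [sub_apply] at h2
    have h3 := norm_add_le_of_le h1 h2
    rw [sub_add_sub_cancel, sub_sub] at h3
    linarith
  have hstep (k : ℕ) : lam (k + 1) * ⟪F (xs (k + 1)), xs (k + 1) - vs (k + 2)⟫ ≤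
      1 / 2 * ‖vs (k + 1) - vs (k + 2)‖ ^ 2 - 1 / 8 * ‖xs (k + 1) - vs (k + 1)‖ ^ 2 := by
    refine mul_inner_le_of_inexact_model (hlampos _) (hlam k).1 (hlam k).2 (herr k) ?_
    have h := hsub k _ (hvsX (k + 2))
    rw [hΩ, add_assoc, ← add_smul] at h
    convert h using 1
    · congr 3
      ring
    · ring
  -- The maximal value of the dual objective is a Lyapunov function.
  have hdual (n : ℕ) : ⟪s n, vs (n + 1) - xs 0⟫ - 1 / 2 * ‖vs (n + 1) - xs 0‖ ^ 2
      + 1 / 8 * ∑ k ∈ Finset.Icc 1 n, ‖xs k - vs k‖ ^ 2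
      ≤ - ∑ k ∈ Finset.Icc 1 n, lam k * ⟪F (xs k), xs k - xs 0⟫ := by
    induction n with
    | zero => simp [hs0]
    | succ n ih =>
      rw [Finset.sum_Icc_succ_top (by omega), Finset.sum_Icc_succ_top (by omega)]
      have h1 := hXconv.prox_objective_le_of_isMax (hvsX (n + 1)) (hvmax n) (hvsX (n + 2))
      have h2 := hstep n
      have h3 : xs (n + 1) - vs (n + 2) = (xs (n + 1) - xs 0) - (vs (n + 2) - xs 0) := by abel
      rw [h3, inner_sub_right] at h2
      rw [hsrec, inner_sub_left, real_inner_smul_left]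
      linarith
  have hs (n : ℕ) : ⟪s n, xstar - xs 0⟫ =
      - ∑ k ∈ Finset.Icc 1 n, lam k * ⟪F (xs k), xstar - xs 0⟫ := by
    induction n with
    | zero => simp [hs0]
    | succ n ih =>
      rw [Finset.sum_Icc_succ_top (by omega), hsrec, inner_sub_left, real_inner_smul_left, ih]
      ring
  have hr : ∑ k ∈ Finset.Icc 1 T, ‖xs k - vs k‖ ^ 2 ≤ 4 * ‖xstar - xs 0‖ ^ 2 := by
    have h1 : ∑ k ∈ Finset.Icc 1 T, lam k * ⟪F (xs k), xstar - xs 0⟫ ≤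
        ∑ k ∈ Finset.Icc 1 T, lam k * ⟪F (xs k), xs k - xs 0⟫ := by
      gcongr with k hk
      · exact (hlampos k).le
      · have h := hminty _ (hxsX k)
        rwa [← sub_sub_sub_cancel_right _ _ (xs 0), inner_sub_right, sub_nonneg] at h
    have h2 := hvmax T _ hxstarX
    rw [hs] at h2
    linarith [hdual T]
  have hbound := (Finset.Icc 1 T).one_div_sum_sq_le (Finset.nonempty_Icc.2 hT) lam
    (fun k => L / 2 * ‖xs k - vs k‖ + δ) (fun k _ => hlampos k) (fun k hk => by
      obtain ⟨j, rfl⟩ := Nat.exists_eq_add_of_le' (Finset.mem_Icc.1 hk).1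
      exact (hlam j).1)
  rw [Nat.card_Icc, Nat.add_sub_cancel] at hbound
  have hsq : ∑ k ∈ Finset.Icc 1 T, (L / 2 * ‖xs k - vs k‖ + δ) ^ 2 ≤
      2 * L ^ 2 * ‖xstar - xs 0‖ ^ 2 + 2 * T * δ ^ 2 := by
    calc _ ≤ ∑ k ∈ Finset.Icc 1 T, (L ^ 2 / 2 * ‖xs k - vs k‖ ^ 2 + 2 * δ ^ 2) := by
          gcongr with k
          nlinarith [sq_nonneg (L / 2 * ‖xs k - vs k‖ - δ)]
      _ = L ^ 2 / 2 * ∑ k ∈ Finset.Icc 1 T, ‖xs k - vs k‖ ^ 2 + T * (2 * δ ^ 2) := by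
          simp [Finset.sum_add_distrib, Finset.mul_sum]
      _ ≤ L ^ 2 / 2 * (4 * ‖xstar - xs 0‖ ^ 2) + T * (2 * δ ^ 2) := by gcongr
      _ = _ := by ring
  have hTpos : (0 : ℝ) < T := by exact_mod_cast hT
  calc _ ≤ _ := hbound
    _ ≤ 1024 * (2 * L ^ 2 * ‖xstar - xs 0‖ ^ 2 + 2 * T * δ ^ 2) / (T : ℝ) ^ 3 := by gcongr
    _ = _ := by
      field_simp
      ring
end

section
/- Let X, F, J, L and the VIJI iterates (x_k, v_k, s_k) with η = 10 be as in the context, except that the step sizes satisfy 1/32 ≤ λ_k · L∥x_k − v_k∥ ≤ 1/22 for all k ≥ 1, and assume F satisfies the Minty condition on X with point x*. Then for every integer T ≥ 1, 1/(∑_{k=1}^T λ_k) ≤ 64 L ∥x* − x_0∥ / T^{3/2}. -/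
open scoped RealInnerProductSpace

/-- The tangent-line bound for the convex function `u ↦ u ^ (-1 / 2)`, with `u = r ^ 2`. -/
theorem three_div_sub_sq_div_le_inv {c r : ℝ} (hc : 0 < c) (hr : 0 < r) :
    3 / (2 * c) - r ^ 2 / (2 * c ^ 3) ≤ r⁻¹ := by
  have h : r⁻¹ - (3 / (2 * c) - r ^ 2 / (2 * c ^ 3))
      = (c - r) ^ 2 * (2 * c + r) / (2 * c ^ 3 * r) := by
    field_simp
    ring
  have : 0 ≤ (c - r) ^ 2 * (2 * c + r) / (2 * c ^ 3 * r) := by positivity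
  linarith

/-- A power mean inequality between the exponents `-1` and `2`. -/
theorem card_mul_sqrt_card_div_le_sum_inv {ι : Type*} {t : Finset ι} (ht : t.Nonempty)
    {r : ι → ℝ} {B : ℝ} (hB : 0 < B) (hr : ∀ i ∈ t, 0 < r i)
    (hsum : ∑ i ∈ t, r i ^ 2 ≤ B ^ 2) :
    t.card * √t.card / B ≤ ∑ i ∈ t, (r i)⁻¹ := by
  have hn : (0 : ℝ) < t.card := by exact_mod_cast ht.card_pos
  obtain ⟨q, hq, hq0, hqq⟩ : ∃ q : ℝ, √t.card = q ∧ 0 < q ∧ (t.card : ℝ) = q ^ 2 :=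
    ⟨_, rfl, Real.sqrt_pos.2 hn, (Real.sq_sqrt hn.le).symm⟩
  rw [hq]
  have hc : 0 < B / q := div_pos hB hq0
  calc t.card * q / B
      = t.card * (3 / (2 * (B / q))) - B ^ 2 / (2 * (B / q) ^ 3) := by
        rw [hqq]
        field_simp
        ring
    _ ≤ t.card * (3 / (2 * (B / q))) - (∑ i ∈ t, r i ^ 2) / (2 * (B / q) ^ 3) := by
        gcongr
    _ = ∑ i ∈ t, (3 / (2 * (B / q)) - r i ^ 2 / (2 * (B / q) ^ 3)) := by
        rw [Finset.sum_sub_distrib, Finset.sum_const, nsmul_eq_mul, Finset.sum_div]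
    _ ≤ ∑ i ∈ t, (r i)⁻¹ :=
        Finset.sum_le_sum fun i hi => three_div_sub_sq_div_le_inv hc (hr i hi)

/-- Lemma on dual step-size control in the exact-adaptive regime: VIJI with
η = 10 and step sizes satisfying `1/32 ≤ λ_k L‖x_k − v_k‖ ≤ 1/22`, under the Minty condition,
satisfies `1/(∑_{k=1}^T λ_k) ≤ 64 L ‖x* − x_0‖ / T^{3/2}` for every `T ≥ 1`. -/
theorem viji_stepsize_control_exact
    (d : ℕ) (X : Set (EuclideanSpace ℝ (Fin d)))
    (hXconv : Convex ℝ X) (hXclosed : IsClosed X) (hXbdd : Bornology.IsBounded X)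
    (F : EuclideanSpace ℝ (Fin d) → EuclideanSpace ℝ (Fin d))
    (F' : EuclideanSpace ℝ (Fin d) → EuclideanSpace ℝ (Fin d) →L[ℝ] EuclideanSpace ℝ (Fin d))
    (hF' : ∀ x, HasFDerivAt F (F' x) x)
    (L δ : ℝ)
    (hsmooth : ∀ x ∈ X, ∀ y ∈ X, ‖F' x - F' y‖ ≤ L * ‖x - y‖)
    (J : EuclideanSpace ℝ (Fin d) → EuclideanSpace ℝ (Fin d) →L[ℝ] EuclideanSpace ℝ (Fin d))
    (hJ : ∀ v ∈ X, ‖F' v - J v‖ ≤ δ)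
    (Ω : EuclideanSpace ℝ (Fin d) → EuclideanSpace ℝ (Fin d) → EuclideanSpace ℝ (Fin d))
    (hΩ : ∀ v x, Ω v x = F v + J v (x - v) + (10 * δ) • (x - v)
      + (5 * L * ‖x - v‖) • (x - v))
    (xs vs s : ℕ → EuclideanSpace ℝ (Fin d)) (lam : ℕ → ℝ)
    (hxsX : ∀ k, xs k ∈ X) (hvsX : ∀ k, vs k ∈ X)
    (hs0 : s 0 = 0)
    (hlampos : ∀ k, 0 < lam k)
    (hvmax : ∀ k, ∀ w ∈ X,
      ⟪s k, w - xs 0⟫ - 1 / 2 * ‖w - xs 0‖ ^ 2 ≤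
        ⟪s k, vs (k + 1) - xs 0⟫ - 1 / 2 * ‖vs (k + 1) - xs 0‖ ^ 2)
    (hsub : ∀ k, ∀ w ∈ X,
      ⟪Ω (vs (k + 1)) (xs (k + 1)), xs (k + 1) - w⟫ ≤
        L / 2 * ‖xs (k + 1) - vs (k + 1)‖ ^ 3 + δ * ‖xs (k + 1) - vs (k + 1)‖ ^ 2)
    (hlam : ∀ k, 1 / 32 ≤ lam (k + 1) * (L * ‖xs (k + 1) - vs (k + 1)‖) ∧
      lam (k + 1) * (L * ‖xs (k + 1) - vs (k + 1)‖) ≤ 1 / 22)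
    (hsrec : ∀ k, s (k + 1) = s k - lam (k + 1) • F (xs (k + 1)))
    (xstar : EuclideanSpace ℝ (Fin d)) (hxstarX : xstar ∈ X)
    (hminty : ∀ x ∈ X, 0 ≤ ⟪F x, x - xstar⟫)
    (hdescent : ∀ T : ℕ, 1 ≤ T → ∀ x ∈ X,
      ∑ k ∈ Finset.Icc 1 T, lam k * ⟪F (xs k), xs k - x⟫
          + 1 / 8 * ∑ k ∈ Finset.Icc 1 T, ‖xs k - vs k‖ ^ 2 ≤
        1 / 2 * ‖x - xs 0‖ ^ 2) :
    ∀ T : ℕ, 1 ≤ T →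
      1 / (∑ k ∈ Finset.Icc 1 T, lam k) ≤
        64 * L * ‖xstar - xs 0‖ / (T : ℝ) ^ ((3 : ℝ) / 2) := by
  intro T hT
  have hprod : ∀ k ∈ Finset.Icc 1 T, 1 / 32 ≤ lam k * (L * ‖xs k - vs k‖) := fun k hk => by
    obtain ⟨j, rfl⟩ := Nat.exists_eq_add_of_le' (Finset.mem_Icc.1 hk).1
    exact (hlam j).1
  have hLr : ∀ k ∈ Finset.Icc 1 T, 0 < L * ‖xs k - vs k‖ := fun k hk =>
    pos_of_mul_pos_right (by linarith [hprod k hk]) (hlampos k).le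
  have h1 : 1 ∈ Finset.Icc 1 T := Finset.mem_Icc.2 ⟨le_rfl, hT⟩
  have hL : 0 < L := pos_of_mul_pos_left (hLr 1 h1) (norm_nonneg _)
  have hr : ∀ k ∈ Finset.Icc 1 T, 0 < ‖xs k - vs k‖ := fun k hk =>
    pos_of_mul_pos_right (hLr k hk) hL.le
  have hsq : ∑ k ∈ Finset.Icc 1 T, ‖xs k - vs k‖ ^ 2 ≤ (2 * ‖xstar - xs 0‖) ^ 2 := by
    have hnonneg : 0 ≤ ∑ k ∈ Finset.Icc 1 T, lam k * ⟪F (xs k), xs k - xstar⟫ :=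
      Finset.sum_nonneg fun k _ => mul_nonneg (hlampos k).le (hminty _ (hxsX k))
    linarith [hdescent T hT xstar hxstarX]
  have hD : 0 < 2 * ‖xstar - xs 0‖ := by
    have hpos : 0 < ∑ k ∈ Finset.Icc 1 T, ‖xs k - vs k‖ ^ 2 :=
      Finset.sum_pos (fun k hk => pow_pos (hr k hk) 2) ⟨1, h1⟩
    exact (by positivity : 0 ≤ 2 * ‖xstar - xs 0‖).lt_of_ne'
      (pow_ne_zero_iff two_ne_zero |>.1 (hpos.trans_le hsq).ne')
  have hmean := card_mul_sqrt_card_div_le_sum_inv ⟨1, h1⟩ hD hr hsq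
  have hlamsum : (∑ k ∈ Finset.Icc 1 T, ‖xs k - vs k‖⁻¹) / (32 * L)
      ≤ ∑ k ∈ Finset.Icc 1 T, lam k := by
    rw [Finset.sum_div]
    refine Finset.sum_le_sum fun k hk => ?_
    have hk0 := hr k hk
    rw [div_le_iff₀ (by positivity), inv_le_iff_one_le_mul₀ hk0]
    linarith [hprod k hk]
  have hT0 : (0 : ℝ) < T := by exact_mod_cast hT
  have hpow : (T : ℝ) ^ ((3 : ℝ) / 2) = T * √T := by
    rw [show (3 : ℝ) / 2 = 1 + 1 / 2 by norm_num, Real.rpow_add hT0, Real.rpow_one,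
      Real.sqrt_eq_rpow]
  rw [Nat.card_Icc, Nat.add_sub_cancel, ← hpow] at hmean
  have hP : 0 < (T : ℝ) ^ ((3 : ℝ) / 2) := by positivity
  have hD' : 0 < ‖xstar - xs 0‖ := by linarith
  calc 1 / ∑ k ∈ Finset.Icc 1 T, lam k
      ≤ 1 / ((T : ℝ) ^ ((3 : ℝ) / 2) / (2 * ‖xstar - xs 0‖) / (32 * L)) := by
        refine one_div_le_one_div_of_le (by positivity) (le_trans ?_ hlamsum)
        gcongr
    _ = 64 * L * ‖xstar - xs 0‖ / (T : ℝ) ^ ((3 : ℝ) / 2) := by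
        field_simp
        norm_num
end

section
/- Let X, F, J, L and the VIJI iterates (x_k, v_k, s_k) with η = 10 be as in the context, where now the inexactness is per-iterate: ∥(∇F(v_k) − J(v_k))(x_k − v_k)∥ ≤ δ_k ∥x_k − v_k∥ with δ_k ≤ (L/2)∥x_k − v_k∥ for all k, the subproblem condition is sup_{x ∈ X} ⟨Ω^η_{v_k}(x_k), x_k − x⟩ ≤ (L/2)∥x_k − v_k∥³ + δ_k∥x_k − v_k∥², and the step sizes satisfy 1/32 ≤ λ_k · L∥x_k − v_k∥ ≤ 1/22. Assume F is monotone on X and has a weak solution x* ∈ X, and let D be the diameter of X. Then for every integer T ≥ 1 and x̃_T = (∑_{k=1}^T λ_k x_k)/(∑_{k=1}^T λ_k), the gap function satisfies gap(x̃_T) = sup_{x ∈ X} ⟨F(x), x̃_T − x⟩ ≤ 32 L D³ / T^{3/2}. -/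
open scoped RealInnerProductSpace

/-- A maximizer over a convex set of a linear function minus half a squared distance satisfies a
quadratic growth inequality. -/
lemma quadratic_growth_of_isMax {E : Type*} [NormedAddCommGroup E] [InnerProductSpace ℝ E]
    {X : Set E} (hX : Convex ℝ X) {s x₀ v : E} (hv : v ∈ X)
    (hmax : ∀ w ∈ X, ⟪s, w - x₀⟫ - 1 / 2 * ‖w - x₀‖ ^ 2 ≤ ⟪s, v - x₀⟫ - 1 / 2 * ‖v - x₀‖ ^ 2)
    {w : E} (hw : w ∈ X) :
    ⟪s, w - x₀⟫ - 1 / 2 * ‖w - x₀‖ ^ 2 + 1 / 2 * ‖w - v‖ ^ 2 ≤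
      ⟪s, v - x₀⟫ - 1 / 2 * ‖v - x₀‖ ^ 2 := by
  have expand (t : ℝ) : ⟪s, v + t • (w - v) - x₀⟫ - 1 / 2 * ‖v + t • (w - v) - x₀‖ ^ 2 =
      ⟪s, v - x₀⟫ - 1 / 2 * ‖v - x₀‖ ^ 2 + t * ⟪s - (v - x₀), w - v⟫
        - t ^ 2 / 2 * ‖w - v‖ ^ 2 := by
    have h : v + t • (w - v) - x₀ = (v - x₀) + t • (w - v) := by abel
    rw [h, norm_add_sq_real, norm_smul, mul_pow, Real.norm_eq_abs, sq_abs]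
    simp only [inner_add_right, inner_smul_right, inner_sub_left s]
    ring
  have first_order : ⟪s - (v - x₀), w - v⟫ ≤ 0 := by
    by_contra! hg
    set g := ⟪s - (v - x₀), w - v⟫ with hg_def
    set n := ‖w - v‖ ^ 2 with hn_def
    have hn : 0 ≤ n := by positivity
    have ht : 0 < g / (g + n) := by positivity
    have ht1 : g / (g + n) ≤ 1 := by
      rw [div_le_one (by positivity)]
      linarith
    have h := hmax _ (hX.add_smul_sub_mem hv hw ⟨ht.le, ht1⟩)
    rw [expand] at h
    have h' : g / (g + n) * (g - g / (g + n) / 2 * n) ≤ 0 := by linarith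
    have hmul : g / (g + n) * (g + n) = g := div_mul_cancel₀ _ (by positivity)
    have : 0 < g - g / (g + n) / 2 * n := by nlinarith
    nlinarith [mul_pos ht this]
  have h := expand 1
  rw [one_smul, add_sub_cancel] at h
  linarith

/-- First-order Taylor estimate on a convex set for a map with Lipschitz derivative. -/
lemma norm_taylor_remainder_le {E : Type*} [NormedAddCommGroup E] [NormedSpace ℝ E]
    {X : Set E} (hX : Convex ℝ X) {F : E → E} {F' : E → E →L[ℝ] E}
    (hF' : ∀ x, HasFDerivAt F (F' x) x) {L : ℝ} (hL : 0 ≤ L)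
    (hsmooth : ∀ x ∈ X, ∀ y ∈ X, ‖F' x - F' y‖ ≤ L * ‖x - y‖)
    {x v : E} (hx : x ∈ X) (hv : v ∈ X) :
    ‖F x - F v - F' v (x - v)‖ ≤ L * ‖x - v‖ * ‖x - v‖ := by
  refine (hX.inter (convex_closedBall v ‖x - v‖)).norm_image_sub_le_of_norm_hasFDerivWithin_le'
    (fun y _ => (hF' y).hasFDerivWithinAt) (fun y hy => ?_) ⟨hv, by simp⟩
    ⟨hx, by simp [dist_eq_norm]⟩
  refine (hsmooth y hy.1 v hv).trans (mul_le_mul_of_nonneg_left ?_ hL)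
  simpa [dist_eq_norm] using hy.2

/-- The scaled model error is absorbed by the quadratic terms. -/
lemma scaled_error_le {r e L δ l A : ℝ} (hl : 0 < l) (hδ : 0 ≤ δ)
    (hδ' : δ ≤ L / 2 * r) (h1 : 1 / 32 ≤ l * (L * r)) (h2 : l * (L * r) ≤ 1 / 22)
    (hA : A ≤ (L * r * r + δ * r) * (r + e) - (10 * δ + 5 * L * r) * r ^ 2
      + (10 * δ + 5 * L * r) * (r * e) + (L / 2 * r ^ 3 + δ * r ^ 2)) :
    l * A - 1 / 2 * e ^ 2 + r ^ 2 / 16 ≤ 0 := by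
  have hb : 0 ≤ l * δ := by positivity
  have hb' : l * δ ≤ l * (L * r) / 2 := by nlinarith
  have hlA := mul_le_mul_of_nonneg_left hA hl.le
  obtain ⟨a, ha⟩ : ∃ a, a = l * (L * r) := ⟨_, rfl⟩
  obtain ⟨b, hb_def⟩ : ∃ b, b = l * δ := ⟨_, rfl⟩
  have key : l * A ≤ r ^ 2 * (-(7 / 2) * a - 8 * b) + e * r * (6 * a + 11 * b) := by
    rw [ha, hb_def]
    linarith
  rw [← ha] at h1 h2 hb'
  rw [← hb_def] at hb hb'
  have hq : (6 * a + 11 * b) ^ 2 / 2 - 7 / 2 * a - 8 * b + 1 / 16 ≤ 0 := by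
    nlinarith [mul_nonneg (sub_nonneg.2 h1) (sub_nonneg.2 h2), mul_nonneg hb (sub_nonneg.2 h2),
      mul_nonneg hb (sub_nonneg.2 hb')]
  nlinarith [sq_nonneg (e - r * (6 * a + 11 * b)), mul_nonneg (sq_nonneg r) (neg_nonneg.2 hq)]

/-- Regularized model steps change the operator value against a test point by a controlled
amount. -/
lemma inner_le_of_model {E : Type*} [NormedAddCommGroup E] [InnerProductSpace ℝ E]
    {f p x v w : E} {B C r : ℝ} (hC : 0 ≤ C) (hB : 0 ≤ B) (hr : ‖x - v‖ = r)
    {A : ℝ} (hp : ‖p‖ ≤ B) (hA : ⟪f - p + C • (x - v), x - w⟫ ≤ A) :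
    ⟪f, x - w⟫ ≤ B * (r + ‖w - v‖) - C * r ^ 2 + C * (r * ‖w - v‖) + A := by
  have hxw : x - w = (x - v) - (w - v) := by abel
  have hp' : ⟪p, x - w⟫ ≤ B * (r + ‖w - v‖) := by
    refine (real_inner_le_norm _ _).trans (mul_le_mul hp ?_ (norm_nonneg _) hB)
    rw [hxw, ← hr]
    exact norm_sub_le _ _
  have hc : r ^ 2 - r * ‖w - v‖ ≤ ⟪x - v, x - w⟫ := by
    rw [hxw, inner_sub_right, real_inner_self_eq_norm_sq, hr]
    have := real_inner_le_norm (x - v) (w - v)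
    rw [hr] at this
    linarith
  rw [inner_add_left, inner_sub_left, real_inner_smul_left] at hA
  have := mul_le_mul_of_nonneg_left hc hC
  linarith

/-- Tangent-line lower bound for the reciprocal, in terms of the square. -/
lemma tangent_le_inv {r m D : ℝ} (hr : 0 < r) (hm : 0 ≤ m) (hD : 0 < D) :
    m ^ 3 / D ^ 3 * (3 / 4 * D ^ 2 / m ^ 2 - r ^ 2 / 16) ≤ r⁻¹ := by
  rcases hm.eq_or_lt with rfl | hm
  · simpa using hr.le
  have h : m ^ 3 / D ^ 3 * (3 / 4 * D ^ 2 / m ^ 2 - r ^ 2 / 16) =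
      (12 * D ^ 2 * m - r ^ 2 * m ^ 3) / (16 * D ^ 3) := by
    field_simp
    ring
  rw [h, div_le_iff₀ (by positivity), inv_mul_eq_div, le_div_iff₀ hr]
  nlinarith [mul_nonneg (sq_nonneg (r * m - 2 * D)) (by positivity : 0 ≤ r * m + 4 * D)]

/-- Theorem 3.2: convergence of VIJI with per-iterate controllable inexactness,
η = 10, opt = 0: under `‖(∇F(v_k) − J(v_k))(x_k − v_k)‖ ≤ δ_k‖x_k − v_k‖` with
`δ_k ≤ (L/2)‖x_k − v_k‖` and steps `1/32 ≤ λ_k L‖x_k − v_k‖ ≤ 1/22`, for monotone `F` with weak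
solution `x*`, `gap(x̃_T) ≤ 32 L D³ / T^{3/2}`. -/
theorem viji_monotone_convergence_exact
    (d : ℕ) (X : Set (EuclideanSpace ℝ (Fin d)))
    (hXconv : Convex ℝ X) (hXclosed : IsClosed X) (hXbdd : Bornology.IsBounded X)
    (F : EuclideanSpace ℝ (Fin d) → EuclideanSpace ℝ (Fin d))
    (F' : EuclideanSpace ℝ (Fin d) → EuclideanSpace ℝ (Fin d) →L[ℝ] EuclideanSpace ℝ (Fin d))
    (hF' : ∀ x, HasFDerivAt F (F' x) x)
    (L : ℝ)
    (hsmooth : ∀ x ∈ X, ∀ y ∈ X, ‖F' x - F' y‖ ≤ L * ‖x - y‖)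
    (J : EuclideanSpace ℝ (Fin d) → EuclideanSpace ℝ (Fin d) →L[ℝ] EuclideanSpace ℝ (Fin d))
    (xs vs s : ℕ → EuclideanSpace ℝ (Fin d)) (lam δs : ℕ → ℝ)
    (hxsX : ∀ k, xs k ∈ X) (hvsX : ∀ k, vs k ∈ X)
    (hs0 : s 0 = 0)
    (hlampos : ∀ k, 0 < lam k)
    (hδk : ∀ k, ‖(F' (vs (k + 1)) - J (vs (k + 1))) (xs (k + 1) - vs (k + 1))‖ ≤
        δs (k + 1) * ‖xs (k + 1) - vs (k + 1)‖ ∧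
      δs (k + 1) ≤ L / 2 * ‖xs (k + 1) - vs (k + 1)‖)
    (Ω : ℕ → EuclideanSpace ℝ (Fin d) → EuclideanSpace ℝ (Fin d))
    (hΩ : ∀ k x, Ω k x = F (vs k) + J (vs k) (x - vs k) + (10 * δs k) • (x - vs k)
      + (5 * L * ‖x - vs k‖) • (x - vs k))
    (hvmax : ∀ k, ∀ w ∈ X,
      ⟪s k, w - xs 0⟫ - 1 / 2 * ‖w - xs 0‖ ^ 2 ≤
        ⟪s k, vs (k + 1) - xs 0⟫ - 1 / 2 * ‖vs (k + 1) - xs 0‖ ^ 2)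
    (hsub : ∀ k, ∀ w ∈ X,
      ⟪Ω (k + 1) (xs (k + 1)), xs (k + 1) - w⟫ ≤
        L / 2 * ‖xs (k + 1) - vs (k + 1)‖ ^ 3 + δs (k + 1) * ‖xs (k + 1) - vs (k + 1)‖ ^ 2)
    (hlam : ∀ k, 1 / 32 ≤ lam (k + 1) * (L * ‖xs (k + 1) - vs (k + 1)‖) ∧
      lam (k + 1) * (L * ‖xs (k + 1) - vs (k + 1)‖) ≤ 1 / 22)
    (hsrec : ∀ k, s (k + 1) = s k - lam (k + 1) • F (xs (k + 1)))
    (hmono : ∀ x ∈ X, ∀ y ∈ X, 0 ≤ ⟪F x - F y, x - y⟫)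
    (xstar : EuclideanSpace ℝ (Fin d)) (hxstarX : xstar ∈ X)
    (hweak : ∀ x ∈ X, 0 ≤ ⟪F x, x - xstar⟫)
    (D : ℝ) (hD : Metric.diam X = D) :
    ∀ T : ℕ, 1 ≤ T →
      sSup ((fun w =>
          ⟪F w, ((∑ k ∈ Finset.Icc 1 T, lam k)⁻¹ •
            ∑ k ∈ Finset.Icc 1 T, lam k • xs k) - w⟫) '' X) ≤
        32 * L * D ^ 3 / (T : ℝ) ^ ((3 : ℝ) / 2) := by
  have hLr (k : ℕ) : 0 < L * ‖xs (k + 1) - vs (k + 1)‖ :=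
    pos_of_mul_pos_right (lt_of_lt_of_le (by norm_num) (hlam k).1) (hlampos _).le
  have hrpos (k : ℕ) : 0 < ‖xs (k + 1) - vs (k + 1)‖ :=
    (norm_nonneg _).lt_of_ne fun h => by simpa [← h] using hLr k
  have hL : 0 < L := pos_of_mul_pos_left (hLr 0) (norm_nonneg _)
  have hdist {x y : EuclideanSpace ℝ (Fin d)} (hx : x ∈ X) (hy : y ∈ X) : ‖x - y‖ ≤ D := by
    rw [← hD, ← dist_eq_norm]
    exact Metric.dist_le_diam_of_mem hXbdd hx hy
  have hDpos : 0 < D := (hrpos 0).trans_le (hdist (hxsX _) (hvsX _))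
  have step (k : ℕ) {w} (hw : w ∈ X) :
      lam (k + 1) * ⟪F (xs (k + 1)), xs (k + 1) - w⟫ - 1 / 2 * ‖w - vs (k + 1)‖ ^ 2
        + ‖xs (k + 1) - vs (k + 1)‖ ^ 2 / 16 ≤ 0 := by
    obtain ⟨hδ1, hδ2⟩ := hδk k
    have hδ0 : 0 ≤ δs (k + 1) :=
      nonneg_of_mul_nonneg_left ((norm_nonneg _).trans hδ1) (hrpos k)
    have hC : 0 ≤ 10 * δs (k + 1) + 5 * L * ‖xs (k + 1) - vs (k + 1)‖ := by positivity
    have hB : 0 ≤ L * ‖xs (k + 1) - vs (k + 1)‖ * ‖xs (k + 1) - vs (k + 1)‖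
        + δs (k + 1) * ‖xs (k + 1) - vs (k + 1)‖ := by positivity
    refine scaled_error_le (hlampos _) hδ0 hδ2 (hlam k).1 (hlam k).2
      (inner_le_of_model hC hB rfl
        (p := (F (xs (k + 1)) - F (vs (k + 1)) - F' (vs (k + 1)) (xs (k + 1) - vs (k + 1)))
          + (F' (vs (k + 1)) - J (vs (k + 1))) (xs (k + 1) - vs (k + 1)))
        (norm_add_le_of_le
          (norm_taylor_remainder_le hXconv hF' hL.le hsmooth (hxsX _) (hvsX _)) hδ1) ?_)
    convert hsub k w hw using 2
    rw [hΩ, sub_apply, add_smul]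
    abel
  have potential (w : EuclideanSpace ℝ (Fin d)) (T : ℕ) :
      ⟪s T, vs (T + 1) - xs 0⟫ - 1 / 2 * ‖vs (T + 1) - xs 0‖ ^ 2 - ⟪s T, w - xs 0⟫
        + ∑ k ∈ Finset.Icc 1 T, (lam k * ⟪F (xs k), xs k - w⟫ + ‖xs k - vs k‖ ^ 2 / 16) ≤ 0 := by
    induction T with
    | zero =>
      simp only [hs0, inner_zero_left]
      simp
    | succ k ih =>
      rw [Finset.sum_Icc_succ_top (by omega)]
      have hg := quadratic_growth_of_isMax hXconv (hvsX (k + 1)) (hvmax k) (hvsX (k + 1 + 1))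
      have hstep := step k (hvsX (k + 1 + 1))
      have hsplit : ⟪F (xs (k + 1)), xs (k + 1) - w⟫ =
          ⟪F (xs (k + 1)), xs (k + 1) - vs (k + 1 + 1)⟫
            + ⟪F (xs (k + 1)), vs (k + 1 + 1) - xs 0⟫ - ⟪F (xs (k + 1)), w - xs 0⟫ := by
        rw [← inner_add_right, ← inner_sub_right]
        congr 1
        abel
      rw [hsrec, hsplit]
      simp only [inner_sub_left, real_inner_smul_left]
      linarith
  intro T hT
  have hT0 : (0 : ℝ) < T := by exact_mod_cast hT
  obtain ⟨m, hm_def⟩ : ∃ m, m = √(T : ℝ) := ⟨_, rfl⟩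
  have hm : 0 < m := hm_def ▸ Real.sqrt_pos.2 hT0
  have hm2 : m ^ 2 = T := hm_def ▸ Real.sq_sqrt hT0.le
  have hpow : (T : ℝ) ^ ((3 : ℝ) / 2) = m ^ 3 := by
    rw [hm_def, Real.sqrt_eq_rpow, ← Real.rpow_natCast, ← Real.rpow_mul hT0.le]
    norm_num
  have hΛpos : 0 < ∑ k ∈ Finset.Icc 1 T, lam k :=
    Finset.sum_pos (fun k _ => hlampos k) ⟨1, by simpa using hT⟩
  have hterm : ∀ k ∈ Finset.Icc 1 T,
      m ^ 3 / D ^ 3 * (3 / 4 * D ^ 2 / m ^ 2 - ‖xs k - vs k‖ ^ 2 / 16) ≤ 32 * L * lam k := by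
    intro k hk
    obtain ⟨j, rfl⟩ := Nat.exists_eq_add_of_le' (Finset.mem_Icc.1 hk).1
    refine (tangent_le_inv (hrpos j) hm.le hDpos).trans ?_
    rw [inv_le_iff_one_le_mul₀ (hrpos j)]
    linarith [(hlam j).1]
  have hΛ : m ^ 3 / D ^ 3 * (D ^ 2 / 2 - ∑ k ∈ Finset.Icc 1 T, ‖xs k - vs k‖ ^ 2 / 16) ≤
      32 * L * ∑ k ∈ Finset.Icc 1 T, lam k := by
    have h := Finset.sum_le_sum hterm
    rw [← Finset.mul_sum, ← Finset.mul_sum, Finset.sum_sub_distrib, Finset.sum_const,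
      Nat.card_Icc, nsmul_eq_mul, Nat.add_sub_cancel, ← hm2,
      mul_div_cancel₀ _ (by positivity)] at h
    refine le_trans (mul_le_mul_of_nonneg_left ?_ (by positivity)) h
    nlinarith
  refine csSup_le (Set.Nonempty.image _ ⟨xstar, hxstarX⟩) ?_
  rintro _ ⟨w, hw, rfl⟩
  have hmonoSum : ∑ k ∈ Finset.Icc 1 T, lam k * ⟪F w, xs k - w⟫ ≤
      ∑ k ∈ Finset.Icc 1 T, lam k * ⟪F (xs k), xs k - w⟫ := by
    refine Finset.sum_le_sum fun k _ => mul_le_mul_of_nonneg_left ?_ (hlampos k).le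
    have := hmono _ (hxsX k) w hw
    rw [inner_sub_left] at this
    linarith
  have hpot := potential w T
  rw [Finset.sum_add_distrib] at hpot
  have hwD : ‖w - xs 0‖ ^ 2 ≤ D ^ 2 :=
    pow_le_pow_left₀ (norm_nonneg _) (hdist hw (hxsX 0)) 2
  have hregret : ∑ k ∈ Finset.Icc 1 T, lam k * ⟪F w, xs k - w⟫ ≤
      D ^ 2 / 2 - ∑ k ∈ Finset.Icc 1 T, ‖xs k - vs k‖ ^ 2 / 16 := by
    linarith [hvmax T w hw]
  have havg : ⟪F w, ((∑ k ∈ Finset.Icc 1 T, lam k)⁻¹ • ∑ k ∈ Finset.Icc 1 T, lam k • xs k) - w⟫ =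
      (∑ k ∈ Finset.Icc 1 T, lam k)⁻¹ * ∑ k ∈ Finset.Icc 1 T, lam k * ⟪F w, xs k - w⟫ := by
    simp only [inner_sub_right, real_inner_smul_right, inner_sum, mul_sub, Finset.sum_sub_distrib,
      ← Finset.sum_mul]
    rw [inv_mul_cancel_left₀ hΛpos.ne']
  simp only [havg, hpow]
  rw [inv_mul_le_iff₀ hΛpos]
  refine hregret.trans ?_
  rw [← mul_div_assoc, le_div_iff₀ (by positivity)]
  rw [div_mul_eq_mul_div, div_le_iff₀ (by positivity)] at hΛ
  linarith
end

section
/- Let J be a d × d real matrix, let s, y ∈ ℝ^d with s ≠ 0 and ∥y∥ ≤ L₀∥s∥, and let α ≥ 1. Then the rank-one Broyden-type update satisfies ∥ J + (1/α)·(y − J s) sᵀ / (sᵀ s) ∥_op ≤ ∥J∥_op + L₀/α, where ∥·∥_op is the operator norm induced by the Euclidean norm. -/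
open scoped RealInnerProductSpace

/-- Subtracting from `h` at most its orthogonal projection onto the line spanned by `s` does not
increase the norm. -/
theorem norm_sub_damped_projection_le {E : Type*} [NormedAddCommGroup E] [InnerProductSpace ℝ E]
    {s : E} (hs : s ≠ 0) {α : ℝ} (hα : 1 ≤ α) (h : E) :
    ‖h - ((α * ⟪s, s⟫)⁻¹ * ⟪s, h⟫) • s‖ ≤ ‖h‖ := by
  have hs' : 0 < ‖s‖ := norm_pos_iff.mpr hs
  have hα' : 0 < α := by linarith
  rw [real_inner_self_eq_norm_sq]
  set t : ℝ := (α * ‖s‖ ^ 2)⁻¹ * ⟪s, h⟫ with ht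
  have hp : ⟪h, s⟫ = α * ‖s‖ ^ 2 * t := by
    rw [ht, real_inner_comm]
    field_simp
  refine le_of_sq_le_sq ?_ (norm_nonneg h)
  rw [norm_sub_sq_real, inner_smul_right, hp, norm_smul, mul_pow, Real.norm_eq_abs, sq_abs]
  nlinarith [mul_nonneg (show (0 : ℝ) ≤ 2 * α - 1 by linarith) (sq_nonneg (t * ‖s‖))]

/-- The damped projection coefficient of `h` along `s`, measured in units of `‖s‖`, is at most
`‖h‖ / α`. -/
theorem abs_damped_projection_coeff_mul_norm_le {E : Type*} [NormedAddCommGroup E]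
    [InnerProductSpace ℝ E] {s : E} (hs : s ≠ 0) {α : ℝ} (hα : 0 < α) (h : E) :
    |(α * ⟪s, s⟫)⁻¹ * ⟪s, h⟫| * ‖s‖ ≤ ‖h‖ / α := by
  have hs' : 0 < ‖s‖ := norm_pos_iff.mpr hs
  rw [real_inner_self_eq_norm_sq, abs_mul, abs_of_pos (by positivity)]
  calc (α * ‖s‖ ^ 2)⁻¹ * |⟪s, h⟫| * ‖s‖
      ≤ (α * ‖s‖ ^ 2)⁻¹ * (‖s‖ * ‖h‖) * ‖s‖ := by
        gcongr
        exact abs_real_inner_le_norm s h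
    _ = ‖h‖ / α := by field_simp

/-- norm growth of one (damped) Broyden update: for a linear operator `J` on
`ℝ^d`, vectors `s ≠ 0`, `y` with `‖y‖ ≤ L₀‖s‖`, and damping `α ≥ 1`, the rank-one update
`J⁺ = J + (1/α)(y − Js)sᵀ/(sᵀs)` satisfies `‖J⁺‖_op ≤ ‖J‖_op + L₀/α`. Here `(u vᵀ) h = ⟪v, h⟫ u`
is realized by `(innerSL ℝ v).smulRight u`. -/
theorem broyden_update_norm_bound
    (d : ℕ) (J : EuclideanSpace ℝ (Fin d) →L[ℝ] EuclideanSpace ℝ (Fin d))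
    (s y : EuclideanSpace ℝ (Fin d)) (hs : s ≠ 0)
    (L₀ α : ℝ) (hy : ‖y‖ ≤ L₀ * ‖s‖) (hα : 1 ≤ α) :
    ‖J + (α * ⟪s, s⟫)⁻¹ • (ContinuousLinearMap.smulRight (innerSL ℝ s) (y - J s))‖ ≤
      ‖J‖ + L₀ / α := by
  have hs' : 0 < ‖s‖ := norm_pos_iff.mpr hs
  have hα' : 0 < α := by linarith
  have hL : 0 ≤ L₀ := nonneg_of_mul_nonneg_left ((norm_nonneg y).trans hy) hs'
  refine ContinuousLinearMap.opNorm_le_bound _ (by positivity) fun h => ?_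
  have hcoeff := abs_damped_projection_coeff_mul_norm_le hs hα' h
  have hproj := norm_sub_damped_projection_le hs hα h
  set t : ℝ := (α * ⟪s, s⟫)⁻¹ * ⟪s, h⟫ with ht
  have key : (J + (α * ⟪s, s⟫)⁻¹ • (ContinuousLinearMap.smulRight (innerSL ℝ s) (y - J s))) h
      = J (h - t • s) + t • y := by
    simp only [add_apply, smul_apply,
      ContinuousLinearMap.smulRight_apply, innerSL_apply_apply, smul_smul, ← ht, map_sub, map_smul,
      smul_sub]
    abel
  rw [key]
  calc ‖J (h - t • s) + t • y‖ ≤ ‖J (h - t • s)‖ + ‖t • y‖ := norm_add_le _ _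
    _ ≤ ‖J‖ * ‖h‖ + |t| * (L₀ * ‖s‖) := by
        rw [norm_smul, Real.norm_eq_abs]
        gcongr
        exact J.le_opNorm_of_le hproj
    _ = ‖J‖ * ‖h‖ + L₀ * (|t| * ‖s‖) := by ring
    _ ≤ ‖J‖ * ‖h‖ + L₀ * (‖h‖ / α) := by gcongr
    _ = (‖J‖ + L₀ / α) * ‖h‖ := by ring
end
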